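/- Let X be a Polish space, P0 and Pθ Borel probability measures on X, and D : P(X) × P(X) → [0,∞) a function satisfying: D(P, P) = 0 for all P; D(P, Q) = D(Q, P); D(P, Q) ≤ D(P, R) + D(R, Q); D(P, (1−λ)Q + λR) ≤ (1−λ)D(P, Q) + λD(P, R) for all λ ∈ (0,1); and D(P_n, Q) → D(P, Q) whenever P_n converges weakly to P. Suppose I_{ε0}(θ) < ∞ for some ε0 ≥ 0, where I_ε(θ) = inf { KL(Q|Pθ) : Q ∈ P(X), D(Q, P0) ≤ ε }, and let ε > ε0. Let x_1, x_2, … be i.i.d. with law P0 (i.e., distributed according to the infinite product measure P0^{⊗∞}). Then (1/n) log L_ε(θ | x_{1:n}) converges in probability to − I_ε(θ) as n → ∞; that is, for every δ > 0, P0^{⊗∞}( { x : | (1/n) log L_ε(θ | x_{1:n}) + I_ε(θ) | > δ } ) → 0, where L_ε(θ | x_{1:n}) = Pθ^{⊗n}( { z ∈ X^n : D(P̂_z, P̂_{x_{1:n}}) ≤ ε } ). -/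

import Mathlib

open MeasureTheory ENNReal Filter Topology
open scoped Classical BigOperators BoundedContinuousFunction

/-- Kullback–Leibler divergence `KL(Q|P) = ∫ log (dQ/dP) dQ` if `Q ≪ P` (and the integral
exists), and `∞` otherwise. -/
noncomputable def KLdiv {X : Type*} [MeasurableSpace X] (Q P : Measure X) : ℝ≥0∞ :=
  if Q ≪ P ∧ Integrable (fun x => Real.log (Q.rnDeriv P x).toReal) Q
  then ENNReal.ofReal (∫ x, Real.log (Q.rnDeriv P x).toReal ∂Q) else ⊤

/-- OKL with respect to a real-valued discrepancy `D`. -/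
noncomputable def OKLD {X : Type*} [MeasurableSpace X]
    (D : Measure X → Measure X → ℝ) (P0 Pθ : Measure X) (r : ℝ) : ℝ≥0∞ :=
  ⨅ Q ∈ {Q : Measure X | IsProbabilityMeasure Q ∧ D Q P0 ≤ r}, KLdiv Q Pθ

/-- Empirical measure of the tuple `z : Fin n → X`. -/
noncomputable def empMeasure {X : Type*} [MeasurableSpace X] {n : ℕ}
    (z : Fin n → X) : Measure X :=
  ((n : ℝ≥0∞))⁻¹ • ∑ i : Fin n, Measure.dirac (z i)

/-- The coarsened likelihood `L_ε(θ|x) = Pθ^{⊗n}( D(P̂_z, P̂_x) ≤ ε )`. -/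
noncomputable def coarsenedLik {X : Type*} [MeasurableSpace X]
    (D : Measure X → Measure X → ℝ) (Pθ : Measure X) {n : ℕ}
    (x : Fin n → X) (ε : ℝ) : ℝ≥0∞ :=
  (Measure.pi fun _ : Fin n => Pθ) {z : Fin n → X | D (empMeasure z) (empMeasure x) ≤ ε}

section IID
open ProbabilityTheory

lemma ae_tendsto_average_infinitePi {Y : Type*} [MeasurableSpace Y] (Q : Measure Y)
    [IsProbabilityMeasure Q] {f : Y → ℝ} (hfm : Measurable f) (hf : Integrable f Q) :
    ∀ᵐ ω ∂(Measure.infinitePi fun _ : ℕ => Q),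
      Tendsto (fun n : ℕ => (∑ i : Fin n, f (ω i)) / (n : ℝ)) atTop (𝓝 (∫ y, f y ∂Q)) := by
  have hmp : ∀ i : ℕ, MeasurePreserving (fun ω : ℕ → Y => ω i)
      (Measure.infinitePi fun _ : ℕ => Q) Q := fun i =>
    measurePreserving_eval_infinitePi (fun _ : ℕ => Q) i
  have hind : iIndepFun (fun (i : ℕ) (ω : ℕ → Y) => f (ω i)) (Measure.infinitePi fun _ : ℕ => Q) :=
    iIndepFun_infinitePi (P := fun _ : ℕ => Q) (X := fun _ => f) fun _ => hfm
  have h := strong_law_ae_real (μ := Measure.infinitePi fun _ : ℕ => Q)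
    (fun i ω => f (ω i)) ((hmp 0).integrable_comp_of_integrable hf)
    (fun i j hij => hind.indepFun hij)
    (fun i => ⟨(hfm.comp (measurable_pi_apply i)).aemeasurable,
      (hfm.comp (measurable_pi_apply 0)).aemeasurable, by
        have key : ∀ i : ℕ, Measure.map (fun ω : ℕ → Y => f (ω i))
            (Measure.infinitePi fun _ : ℕ => Q) = Q.map f := fun i => by
          rw [← (hmp i).map_eq, Measure.map_map hfm (measurable_pi_apply i)]
          simp [(hmp i).map_eq, Function.comp_def]
        rw [key, key]⟩)
  have he : ∫ ω, f (ω 0) ∂(Measure.infinitePi fun _ : ℕ => Q) = ∫ y, f y ∂Q := by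
    conv_rhs => rw [← (hmp 0).map_eq]
    rw [integral_map (measurable_pi_apply 0).aemeasurable hfm.aestronglyMeasurable]
  filter_upwards [h] with ω hω
  rw [he] at hω
  simpa only [Finset.sum_range] using hω

lemma isProbabilityMeasure_empMeasure {Y : Type*} [MeasurableSpace Y] {n : ℕ} (hn : n ≠ 0)
    (z : Fin n → Y) : IsProbabilityMeasure (empMeasure z) := by
  constructor
  simp only [empMeasure, Measure.smul_apply, Measure.finsetSum_apply, measure_univ,
    Finset.sum_const, Finset.card_univ, Fintype.card_fin, smul_eq_mul, nsmul_eq_mul, mul_one]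
  exact ENNReal.inv_mul_cancel (by exact_mod_cast hn) (ENNReal.natCast_ne_top n)

lemma integral_empMeasure {Y : Type*} [MeasurableSpace Y] {n : ℕ}
    (z : Fin n → Y) {f : Y → ℝ} (hf : Measurable f) :
    ∫ y, f y ∂(empMeasure z) = (∑ i, f (z i)) / (n : ℝ) := by
  have hd : ∀ y : Y, Integrable f (Measure.dirac y) := fun y =>
    (integrable_dirac' hf.stronglyMeasurable (by simp))
  rw [empMeasure, integral_smul_measure, integral_finsetSum_measure fun i _ => hd _]
  simp_rw [integral_dirac' f _ hf.stronglyMeasurable]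
  simp [div_eq_inv_mul]

lemma ae_tendsto_integral_empMeasure {Y : Type*} [MeasurableSpace Y] [TopologicalSpace Y]
    [PolishSpace Y] [BorelSpace Y] (Q : Measure Y) [IsProbabilityMeasure Q] :
    ∀ᵐ ω ∂(Measure.infinitePi fun _ : ℕ => Q), ∀ f : Y →ᵇ ℝ,
      Tendsto (fun n : ℕ => ∫ y, f y ∂(empMeasure fun i : Fin (n + 1) => ω i)) atTop
        (𝓝 (∫ y, f y ∂Q)) := by
  let _ := TopologicalSpace.upgradeIsCompletelyMetrizable Y
  have hB := TopologicalSpace.isBasis_countableBasis Y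
  have hcount : ∀ᵐ ω ∂(Measure.infinitePi fun _ : ℕ => Q),
      ∀ t : Finset (TopologicalSpace.countableBasis Y),
      Tendsto (fun n : ℕ => (∑ i : Fin n, (⋃ s ∈ t, (s : Set Y)).indicator (fun _ => (1 : ℝ)) (ω i))
        / (n : ℝ)) atTop
        (𝓝 (∫ y, (⋃ s ∈ t, (s : Set Y)).indicator (fun _ => (1 : ℝ)) y ∂Q)) := by
    have : Countable (TopologicalSpace.countableBasis Y) :=
      (TopologicalSpace.countable_countableBasis Y).to_subtype
    rw [ae_all_iff]
    intro t
    have hm : MeasurableSet (⋃ s ∈ t, (s : Set Y)) :=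
      (isOpen_biUnion fun s _ => hB.isOpen s.2).measurableSet
    exact ae_tendsto_average_infinitePi Q (measurable_const.indicator hm)
      ((integrable_const 1).indicator hm)
  filter_upwards [hcount] with ω hω
  have hp : ∀ n : ℕ, IsProbabilityMeasure (empMeasure fun i : Fin (n + 1) => ω i) := fun n =>
    isProbabilityMeasure_empMeasure n.succ_ne_zero _
  let ν : ℕ → ProbabilityMeasure Y := fun n => ⟨empMeasure fun i : Fin (n + 1) => ω i, hp n⟩
  let ν' : ProbabilityMeasure Y := ⟨Q, inferInstance⟩
  have hT : Tendsto ν atTop (𝓝 ν') := by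
    refine tendsto_of_forall_isOpen_le_liminf_nat' fun U hU => ?_
    change Q U ≤ liminf (fun n : ℕ => (empMeasure fun i : Fin (n + 1) => ω i) U) atTop
    have hUnion : U = ⋃ t : {t : Finset (TopologicalSpace.countableBasis Y) //
        (⋃ s ∈ t, (s : Set Y)) ⊆ U}, ⋃ s ∈ t.1, (s : Set Y) := by
      apply Set.Subset.antisymm
      · intro y hy
        obtain ⟨s, hs, hys, hsU⟩ := hB.exists_subset_of_mem_open hy hU
        exact Set.mem_iUnion.2 ⟨⟨{⟨s, hs⟩}, by simpa using hsU⟩, by simpa using hys⟩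
      · exact Set.iUnion_subset fun t => t.2
    have hdir : Directed (· ⊆ ·) fun t : {t : Finset (TopologicalSpace.countableBasis Y) //
        (⋃ s ∈ t, (s : Set Y)) ⊆ U} => ⋃ s ∈ t.1, (s : Set Y) := by
      intro t t'
      refine ⟨⟨t.1 ∪ t'.1, ?_⟩, ?_, ?_⟩
      · rw [Finset.set_biUnion_union]
        exact Set.union_subset t.2 t'.2
      · exact Set.biUnion_subset_biUnion_left fun s hs => Finset.mem_union_left _ hs
      · exact Set.biUnion_subset_biUnion_left fun s hs => Finset.mem_union_right _ hs
    have : Countable (TopologicalSpace.countableBasis Y) :=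
      (TopologicalSpace.countable_countableBasis Y).to_subtype
    conv_lhs => rw [hUnion]
    rw [hdir.measure_iUnion]
    refine iSup_le fun t => ?_
    have hm : MeasurableSet (⋃ s ∈ t.1, (s : Set Y)) :=
      (isOpen_biUnion fun s _ => hB.isOpen s.2).measurableSet
    have h1 : Tendsto (fun n : ℕ => (empMeasure fun i : Fin (n + 1) => ω i)
        (⋃ s ∈ t.1, (s : Set Y))) atTop (𝓝 (Q (⋃ s ∈ t.1, (s : Set Y)))) := by
      rw [← ENNReal.tendsto_toReal_iff (fun n => measure_ne_top _ _) (measure_ne_top _ _)]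
      have h2 := (tendsto_add_atTop_iff_nat 1).2 (hω t.1)
      rw [integral_indicator_const _ hm] at h2
      refine Tendsto.congr (fun n => ?_) (by simpa [Measure.real] using h2)
      have h3 := integral_empMeasure (fun i : Fin (n + 1) => ω i)
        ((measurable_const (a := (1 : ℝ))).indicator hm)
      rw [integral_indicator_const _ hm] at h3
      simpa [Measure.real] using h3.symm
    rw [← h1.liminf_eq]
    exact liminf_le_liminf (Eventually.of_forall fun n => measure_mono t.2)
  rw [ProbabilityMeasure.tendsto_iff_forall_integral_tendsto] at hT
  exact hT

lemma tendsto_pi_of_ae_eventually {Y : Type*} [MeasurableSpace Y] (Q : Measure Y)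
    [IsProbabilityMeasure Q] {E : ∀ n : ℕ, Set (Fin n → Y)} (hE : ∀ n, MeasurableSet (E n))
    (h : ∀ᵐ ω ∂(Measure.infinitePi fun _ : ℕ => Q), ∀ᶠ n in atTop,
      (fun i : Fin n => ω i) ∈ E n) :
    Tendsto (fun n => (Measure.pi fun _ : Fin n => Q) (E n)) atTop (𝓝 1) := by
  have hind : iIndepFun (fun (i : ℕ) (ω : ℕ → Y) => ω i) (Measure.infinitePi fun _ : ℕ => Q) :=
    iIndepFun_infinitePi (P := fun _ : ℕ => Q) (X := fun _ y => y) fun _ => measurable_id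
  have hr : ∀ n : ℕ, Measurable (fun (ω : ℕ → Y) (i : Fin n) => ω i) := fun n => by fun_prop
  have hmap : ∀ n : ℕ, (Measure.infinitePi fun _ : ℕ => Q).map
      (fun (ω : ℕ → Y) (i : Fin n) => ω i) = Measure.pi fun _ : Fin n => Q := fun n => by
    have h1 := (hind.precomp (g := fun i : Fin n => (i : ℕ)) Fin.val_injective)
    have h2 := (iIndepFun_iff_map_fun_eq_pi_map
      (fun i : Fin n => (measurable_pi_apply (i : ℕ)).aemeasurable)).1 h1
    refine h2.trans ?_
    congr 1
    funext i
    exact (measurePreserving_eval_infinitePi (fun _ : ℕ => Q) i).map_eq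
  have key := tendsto_measure_of_ae_tendsto_indicator_of_isFiniteMeasure
    (μ := Measure.infinitePi fun _ : ℕ => Q) (L := atTop) (A := Set.univ)
    (As := fun n : ℕ => (fun (ω : ℕ → Y) (i : Fin n) => ω i) ⁻¹' E n) MeasurableSet.univ
    (fun n => hr n (hE n)) (by
      filter_upwards [h] with ω hω
      filter_upwards [hω] with n hn
      simpa using hn)
  rw [measure_univ] at key
  refine key.congr fun n => ?_
  rw [← hmap n, Measure.map_apply (hr n) (hE n)]

end IID

section Density
open ProbabilityTheory

lemma lintegral_pi_prod {Y : Type*} [MeasurableSpace Y] (P : Measure Y) [IsProbabilityMeasure P]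
    {n : ℕ} {g : Fin n → Y → ℝ≥0∞} (hg : ∀ i, Measurable (g i)) :
    ∫⁻ z, ∏ i, g i (z i) ∂(Measure.pi fun _ : Fin n => P) = ∏ i, ∫⁻ y, g i y ∂P := by
  have hind : iIndepFun (fun (i : Fin n) (z : Fin n → Y) => g i (z i))
      (Measure.pi fun _ : Fin n => P) :=
    iIndepFun_pi (μ := fun _ : Fin n => P) fun i => (hg i).aemeasurable
  rw [lintegral_prod_eq_prod_lintegral_of_indepFun _ _ hind
    fun i => (hg i).comp (measurable_pi_apply i)]
  refine Finset.prod_congr rfl fun i _ => ?_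
  exact (measurePreserving_eval (fun _ : Fin n => P) i).lintegral_comp (hg i)

lemma pi_withDensity_eq {Y : Type*} [MeasurableSpace Y] (P : Measure Y) [IsProbabilityMeasure P]
    {g : Y → ℝ≥0∞} (hg : Measurable g) [IsProbabilityMeasure (P.withDensity g)] (n : ℕ) :
    (Measure.pi fun _ : Fin n => P.withDensity g) =
      (Measure.pi fun _ : Fin n => P).withDensity fun z => ∏ i, g (z i) := by
  refine Measure.pi_eq fun s hs => ?_
  rw [withDensity_apply _ (MeasurableSet.univ_pi hs),
    ← lintegral_indicator (MeasurableSet.univ_pi hs)]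
  have h : ∀ z : Fin n → Y, (Set.univ.pi s).indicator (fun z => ∏ i, g (z i)) z =
      ∏ i, (s i).indicator g (z i) := by
    intro z
    by_cases hz : z ∈ Set.univ.pi s
    · rw [Set.indicator_of_mem hz]
      exact Finset.prod_congr rfl fun i _ =>
        (Set.indicator_of_mem (hz i (Set.mem_univ i)) g).symm
    · rw [Set.indicator_of_notMem hz]
      simp only [Set.mem_pi, Set.mem_univ, true_implies, not_forall] at hz
      obtain ⟨i, hi⟩ := hz
      exact (Finset.prod_eq_zero (Finset.mem_univ i) (Set.indicator_of_notMem hi g)).symm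
  simp_rw [h]
  rw [lintegral_pi_prod P fun i => hg.indicator (hs i)]
  exact Finset.prod_congr rfl fun i _ => by
    rw [lintegral_indicator (hs i), withDensity_apply _ (hs i)]

lemma pi_le_exp_mul_pi {Y : Type*} [MeasurableSpace Y] (P Q : Measure Y) [IsProbabilityMeasure P]
    [IsProbabilityMeasure Q] (hQP : Q ≪ P) {n : ℕ} {E : Set (Fin n → Y)} (hE : MeasurableSet E)
    {b : ℝ} (hb : ∀ z ∈ E, ∑ i, Real.log (Q.rnDeriv P (z i)).toReal ≤ b) :
    (Measure.pi fun _ : Fin n => Q) E ≤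
      ENNReal.ofReal (Real.exp b) * (Measure.pi fun _ : Fin n => P) E := by
  have hgm : Measurable fun y => ENNReal.ofReal (Q.rnDeriv P y).toReal := by fun_prop
  have hQ : P.withDensity (fun y => ENNReal.ofReal (Q.rnDeriv P y).toReal) = Q := by
    conv_rhs => rw [← Measure.withDensity_rnDeriv_eq Q P hQP]
    refine withDensity_congr_ae ?_
    filter_upwards [Q.rnDeriv_lt_top P] with y hy using ENNReal.ofReal_toReal hy.ne
  have : IsProbabilityMeasure
      (P.withDensity (fun y => ENNReal.ofReal (Q.rnDeriv P y).toReal)) := by rwa [hQ]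
  have hpi := pi_withDensity_eq P hgm n
  rw [hQ] at hpi
  rw [hpi, withDensity_apply _ hE]
  refine (setLIntegral_mono measurable_const (g := fun _ => ENNReal.ofReal (Real.exp b))
    fun z hz => ?_).trans (by rw [setLIntegral_const])
  rw [← ENNReal.ofReal_prod_of_nonneg fun i _ => ENNReal.toReal_nonneg]
  refine ENNReal.ofReal_le_ofReal ?_
  by_cases h0 : ∃ i, (Q.rnDeriv P (z i)).toReal = 0
  · obtain ⟨i, hi⟩ := h0
    rw [Finset.prod_eq_zero (Finset.mem_univ i) hi]
    positivity
  · push Not at h0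
    rw [← Real.log_le_iff_le_exp (Finset.prod_pos fun i _ =>
      lt_of_le_of_ne ENNReal.toReal_nonneg (h0 i).symm), Real.log_prod fun i _ => h0 i]
    exact hb z hz

end Density

section Empirical

/-- A real functional on measures that is sequentially continuous along weakly convergent
sequences of probability measures. -/
def WeaklySeqContinuous {X : Type*} [MeasurableSpace X] [TopologicalSpace X]
    (φ : Measure X → ℝ) : Prop :=
  ∀ (Ps : ℕ → Measure X) (P : Measure X), (∀ n, IsProbabilityMeasure (Ps n)) →
    IsProbabilityMeasure P →
    (∀ f : X →ᵇ ℝ, Tendsto (fun n => ∫ x, f x ∂(Ps n)) atTop (𝓝 (∫ x, f x ∂P))) →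
    Tendsto (fun n => φ (Ps n)) atTop (𝓝 (φ P))

variable {X : Type*} [MeasurableSpace X] [TopologicalSpace X] [PolishSpace X] [BorelSpace X]

lemma WeaklySeqContinuous.continuous_empMeasure {φ : Measure X → ℝ} (hφ : WeaklySeqContinuous φ)
    {n : ℕ} (hn : n ≠ 0) : Continuous fun z : Fin n → X => φ (empMeasure z) := by
  let _ := TopologicalSpace.upgradeIsCompletelyMetrizable X
  refine continuous_iff_seqContinuous.2 fun u z hu => ?_
  refine hφ _ _ (fun k => isProbabilityMeasure_empMeasure hn _)
    (isProbabilityMeasure_empMeasure hn _) fun f => ?_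
  simp_rw [integral_empMeasure _ f.continuous.measurable]
  exact (tendsto_finsetSum _ fun i _ =>
    (f.continuous.tendsto _).comp (tendsto_pi_nhds.1 hu i)).div_const _

lemma WeaklySeqContinuous.measurable_empMeasure {φ : Measure X → ℝ} (hφ : WeaklySeqContinuous φ)
    {n : ℕ} : Measurable fun z : Fin n → X => φ (empMeasure z) := by
  rcases eq_or_ne n 0 with rfl | hn
  · exact fun s _ => Subsingleton.measurableSet
  · exact (hφ.continuous_empMeasure hn).measurable

lemma WeaklySeqContinuous.tendsto_pi {φ : Measure X → ℝ} (hφ : WeaklySeqContinuous φ)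
    (Q : Measure X) [IsProbabilityMeasure Q] {a c : ℝ} (ha : φ Q < a) {f : X → ℝ}
    (hfm : Measurable f) (hf : Integrable f Q) (hc : ∫ x, f x ∂Q < c) :
    Tendsto (fun n : ℕ => (Measure.pi fun _ : Fin n => Q)
      {z | φ (empMeasure z) < a ∧ ∑ i, f (z i) ≤ n * c}) atTop (𝓝 1) := by
  refine tendsto_pi_of_ae_eventually Q (fun n => ?_) ?_
  · exact (measurableSet_lt hφ.measurable_empMeasure measurable_const).inter
      (measurableSet_le (Finset.measurable_fun_sum _ fun i _ =>
        hfm.comp (measurable_pi_apply i)) measurable_const)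
  · filter_upwards [ae_tendsto_integral_empMeasure Q, ae_tendsto_average_infinitePi Q hfm hf]
      with ω h1 h2
    have h3 := hφ _ Q (fun n => isProbabilityMeasure_empMeasure n.succ_ne_zero _) inferInstance h1
    have h4 := (tendsto_add_atTop_iff_nat (f := fun n => φ (empMeasure fun i : Fin n => ω i)) 1).1 h3
    filter_upwards [h4.eventually_lt_const ha, h2.eventually_lt_const hc, eventually_gt_atTop 0]
      with n hn1 hn2 hn3
    refine ⟨hn1, ?_⟩
    have : (0 : ℝ) < n := by exact_mod_cast hn3
    rw [div_lt_iff₀ this] at hn2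
    linarith

end Empirical

section Barycenter

/-- The average of the one-dimensional marginals of a measure on `Fin n → X`. -/
noncomputable def averageMarginal {X : Type*} [MeasurableSpace X] {n : ℕ}
    (R : Measure (Fin n → X)) : Measure X :=
  ((n : ℝ≥0∞))⁻¹ • ∑ i : Fin n, R.map fun z => z i

lemma isProbabilityMeasure_averageMarginal {X : Type*} [MeasurableSpace X] {n : ℕ} (hn : n ≠ 0)
    (R : Measure (Fin n → X)) [IsProbabilityMeasure R] :
    IsProbabilityMeasure (averageMarginal R) := by
  have h : ∀ i : Fin n, (R.map fun z => z i) Set.univ = 1 := fun i => by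
    rw [Measure.map_apply (measurable_pi_apply i) MeasurableSet.univ, Set.preimage_univ,
      measure_univ]
  constructor
  simp only [averageMarginal, Measure.smul_apply, Measure.finsetSum_apply, h,
    Finset.sum_const, Finset.card_univ, Fintype.card_fin, smul_eq_mul, nsmul_eq_mul, mul_one]
  exact ENNReal.inv_mul_cancel (by exact_mod_cast hn) (ENNReal.natCast_ne_top n)

lemma integral_averageMarginal {X : Type*} [MeasurableSpace X] {n : ℕ}
    (R : Measure (Fin n → X)) [IsProbabilityMeasure R] {f : X → ℝ} (hf : Measurable f)
    {C : ℝ} (hC : ∀ x, |f x| ≤ C) :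
    ∫ x, f x ∂(averageMarginal R) = (∫ z : Fin n → X, (∑ i, f (z i)) ∂(R)) / (n : ℝ) := by
  have hfi : ∀ i : Fin n, Integrable (fun z : Fin n → X => f (z i)) R := fun i =>
    Integrable.of_bound (hf.comp (measurable_pi_apply i)).aestronglyMeasurable C
      (ae_of_all _ fun z => hC _)
  have hmap : ∀ i : Fin n, Integrable f (R.map fun z => z i) := fun i =>
    (integrable_map_measure hf.aestronglyMeasurable (measurable_pi_apply i).aemeasurable).2 (hfi i)
  rw [averageMarginal, integral_smul_measure, integral_finsetSum_measure fun i _ => hmap i,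
    integral_finsetSum _ fun i _ => hfi i]
  simp_rw [fun i : Fin n => integral_map (μ := R) (measurable_pi_apply i).aemeasurable
    (f := f) hf.aestronglyMeasurable]
  simp [div_eq_inv_mul]

lemma averageMarginal_le_smul {X : Type*} [MeasurableSpace X] (P : Measure X)
    [IsProbabilityMeasure P] {n : ℕ} (hn : n ≠ 0) {R : Measure (Fin n → X)} {M : NNReal}
    (hR : R ≤ M • Measure.pi fun _ : Fin n => P) : averageMarginal R ≤ M • P := by
  refine Measure.le_iff.2 fun s hs => ?_
  have h : ∀ i : Fin n, (R.map fun z => z i) s ≤ M • P s := fun i => by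
    rw [Measure.map_apply (measurable_pi_apply i) hs]
    refine (hR _).trans (le_of_eq ?_)
    have := (measurePreserving_eval (fun _ : Fin n => P) i).measure_preimage hs.nullMeasurableSet
    rw [Measure.smul_apply]
    congr 1
  rw [averageMarginal, Measure.smul_apply, Measure.finsetSum_apply, Measure.smul_apply]
  calc (n : ℝ≥0∞)⁻¹ • ∑ i : Fin n, (R.map fun z => z i) s
      ≤ (n : ℝ≥0∞)⁻¹ • ∑ _i : Fin n, M • P s := by
        gcongr
        exact h _
    _ = M • P s := by
        rw [Finset.sum_const, Finset.card_univ, Fintype.card_fin, nsmul_eq_mul, smul_eq_mul,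
          ← mul_assoc, ENNReal.inv_mul_cancel (by exact_mod_cast hn) (ENNReal.natCast_ne_top n),
          one_mul]

lemma integral_averageMarginal_le {X : Type*} [MeasurableSpace X] (P : Measure X)
    [IsProbabilityMeasure P] {n : ℕ} (hn : n ≠ 0) {R : Measure (Fin n → X)}
    [IsProbabilityMeasure R] {M : NNReal} (hR : R ≤ M • Measure.pi fun _ : Fin n => P)
    {f : X → ℝ} (hf : Measurable f) {C : ℝ} (hC : ∀ x, |f x| ≤ C) :
    ∫ x, f x ∂(averageMarginal R) ≤ Real.log M / n + Real.log (∫ x, Real.exp (f x) ∂P) := by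
  have hn' : (0 : ℝ) < n := by positivity
  have hsum : Measurable fun z : Fin n → X => ∑ i, f (z i) :=
    Finset.measurable_fun_sum _ fun i _ => hf.comp (measurable_pi_apply i)
  have hsumC : ∀ z : Fin n → X, |∑ i, f (z i)| ≤ n * C := fun z =>
    (Finset.abs_sum_le_sum_abs _ _).trans
      ((Finset.sum_le_sum fun i _ => hC (z i)).trans (by simp))
  have hexpi : ∀ (ν : Measure (Fin n → X)) [IsFiniteMeasure ν],
      Integrable (fun z => Real.exp (∑ i, f (z i))) ν := fun ν _ =>
    Integrable.of_bound (Real.measurable_exp.comp hsum).aestronglyMeasurable (Real.exp (n * C))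
      (ae_of_all _ fun z => by
        rw [Real.norm_of_nonneg (Real.exp_pos _).le]
        exact Real.exp_le_exp.2 ((le_abs_self _).trans (hsumC z)))
  have hjensen : Real.exp (∫ z : Fin n → X, (∑ i, f (z i)) ∂(R)) ≤ ∫ z, Real.exp (∑ i, f (z i)) ∂(R) :=
    convexOn_exp.map_integral_le Real.continuous_exp.continuousOn isClosed_univ
      (ae_of_all _ fun _ => Set.mem_univ _)
      (Integrable.of_bound hsum.aestronglyMeasurable (n * C) (ae_of_all _ hsumC)) (hexpi R)
  have hmono : ∫ z : Fin n → X, Real.exp (∑ i, f (z i)) ∂(R) ≤ M * (∫ x, Real.exp (f x) ∂P) ^ n := by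
    refine (integral_mono_measure hR (ae_of_all _ fun z => (Real.exp_pos _).le)
      (hexpi _)).trans (le_of_eq ?_)
    rw [integral_smul_nnreal_measure]
    simp_rw [Real.exp_sum]
    rw [integral_fintype_prod_eq_pow (fun x => Real.exp (f x)), Fintype.card_fin]
    rfl
  have hexpP : 0 < ∫ x, Real.exp (f x) ∂P :=
    integral_exp_pos (Integrable.of_bound (Real.measurable_exp.comp hf).aestronglyMeasurable
      (Real.exp C) (ae_of_all _ fun x => by
        rw [Real.norm_of_nonneg (Real.exp_pos _).le]
        exact Real.exp_le_exp.2 ((le_abs_self _).trans (hC x))))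
  have hpos := (Real.exp_pos _).trans_le (hjensen.trans hmono)
  have hM : (M : ℝ) ≠ 0 := fun h => by simp [h] at hpos
  have hlog := (Real.le_log_iff_exp_le hpos).2 (hjensen.trans hmono)
  rw [Real.log_mul hM (by positivity), Real.log_pow] at hlog
  rw [integral_averageMarginal R hf hC, div_le_iff₀ hn', add_mul, div_mul_cancel₀ _ hn'.ne']
  linarith

lemma KLdiv_averageMarginal_le {X : Type*} [MeasurableSpace X] (P : Measure X)
    [IsProbabilityMeasure P] {n : ℕ} (hn : n ≠ 0) {R : Measure (Fin n → X)}
    [IsProbabilityMeasure R] {M : NNReal} (hR : R ≤ M • Measure.pi fun _ : Fin n => P) :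
    KLdiv (averageMarginal R) P ≤ ENNReal.ofReal (Real.log M / n) := by
  have := isProbabilityMeasure_averageMarginal hn R
  set Q := averageMarginal R with hQ
  have hQle : Q ≤ M • P := averageMarginal_le_smul P hn hR
  have hac : Q ≪ P := (Measure.absolutelyContinuous_of_le hQle).trans
    (Measure.smul_absolutelyContinuous)
  have hdens : ∀ᵐ x ∂P, (Q.rnDeriv P x).toReal ≤ M := by
    have : Q.rnDeriv P ≤ᵐ[P] fun _ => (M : ℝ≥0∞) := by
      refine ae_le_of_forall_setLIntegral_le_of_sigmaFinite (Measure.measurable_rnDeriv _ _)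
        fun s hs _ => ?_
      rw [setLIntegral_const]
      exact (Measure.setLIntegral_rnDeriv_le s).trans (hQle s)
    filter_upwards [this] with x hx using ENNReal.toReal_le_coe_of_le_coe hx
  have hpos : ∀ᵐ x ∂Q, 0 < (Q.rnDeriv P x).toReal := by
    filter_upwards [Measure.rnDeriv_pos hac, hac.ae_le (Q.rnDeriv_lt_top P)] with x h0 h1
    exact ENNReal.toReal_pos h0.ne' h1.ne
  have hlogint : Integrable (fun x => Real.log (Q.rnDeriv P x).toReal) Q := by
    rw [← integrable_rnDeriv_smul_iff hac]
    obtain ⟨C, hC⟩ := (isCompact_Icc (a := (0 : ℝ)) (b := M)).exists_bound_of_continuousOn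
      Real.continuous_mul_log.continuousOn
    refine Integrable.of_bound (by fun_prop) C ?_
    filter_upwards [hdens] with x hx
    exact hC _ ⟨ENNReal.toReal_nonneg, hx⟩
  rw [KLdiv, if_pos ⟨hac, hlogint⟩]
  refine ENNReal.ofReal_le_ofReal (le_of_forall_pos_le_add fun s hs => ?_)
  have hclip : Measurable fun x => max (min (Q.rnDeriv P x).toReal M) s := by fun_prop
  have hbound : ∀ x, |Real.log (max (min (Q.rnDeriv P x).toReal M) s)| ≤
      max |Real.log s| |Real.log (max (M : ℝ) s)| := fun x => by
    refine abs_le_max_abs_abs (Real.log_le_log hs (le_max_right _ _))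
      (Real.log_le_log (lt_max_of_lt_right hs) ?_)
    exact max_le_max (min_le_right _ _) le_rfl
  have hdv := integral_averageMarginal_le P hn hR (Real.measurable_log.comp hclip) hbound
  rw [← hQ] at hdv
  have hle : ∫ x, Real.log (Q.rnDeriv P x).toReal ∂Q ≤
      ∫ x, Real.log (max (min (Q.rnDeriv P x).toReal M) s) ∂Q := by
    refine integral_mono_ae hlogint (Integrable.of_bound
      (Real.measurable_log.comp hclip).aestronglyMeasurable _ (ae_of_all _ hbound)) ?_
    filter_upwards [hpos, hac.ae_le hdens] with x hx hxM
    rw [min_eq_left hxM]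
    exact Real.log_le_log hx (le_max_left _ _)
  have hmass : Real.log (∫ x, Real.exp (Real.log (max (min (Q.rnDeriv P x).toReal M) s)) ∂P) ≤
      s := by
    have he : ∀ x, Real.exp (Real.log (max (min (Q.rnDeriv P x).toReal M) s)) =
        max (min (Q.rnDeriv P x).toReal M) s := fun x => Real.exp_log (lt_max_of_lt_right hs)
    simp_rw [he]
    have hdi : Integrable (fun x => (Q.rnDeriv P x).toReal) P := Measure.integrable_toReal_rnDeriv
    have h1 : ∫ x, max (min (Q.rnDeriv P x).toReal M) s ∂P ≤
        ∫ x, ((Q.rnDeriv P x).toReal + s) ∂P := by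
      refine integral_mono_of_nonneg (ae_of_all _ fun x => hs.le.trans (le_max_right _ _))
        (hdi.add (integrable_const s)) (ae_of_all _ fun x => ?_)
      have : 0 ≤ (Q.rnDeriv P x).toReal := ENNReal.toReal_nonneg
      exact max_le ((min_le_left _ _).trans (by linarith)) (by linarith)
    rw [integral_add hdi (integrable_const s), Measure.integral_toReal_rnDeriv hac] at h1
    simp only [probReal_univ, integral_const, smul_eq_mul, one_mul] at h1
    have h2 : s ≤ ∫ x, max (min (Q.rnDeriv P x).toReal M) s ∂P := by
      have := integral_mono (μ := P) (integrable_const s)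
        (Integrable.of_bound hclip.aestronglyMeasurable (max M s) (ae_of_all _ fun x => by
          rw [Real.norm_of_nonneg (hs.le.trans (le_max_right _ _))]
          exact max_le_max (min_le_right _ _) le_rfl))
        (fun x => le_max_right (min (Q.rnDeriv P x).toReal M) s)
      simpa using this
    linarith [Real.log_le_sub_one_of_pos (hs.trans_le h2)]
  simp only [Function.comp_apply] at hdv
  linarith

end Barycenter

section Convexity

/-- Convexity of a real functional along mixtures of probability measures. -/
def MixtureConvex {X : Type*} [MeasurableSpace X] (φ : Measure X → ℝ) : Prop :=
  ∀ Q R : Measure X, IsProbabilityMeasure Q → IsProbabilityMeasure R → ∀ lam : ℝ, 0 < lam →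
    lam < 1 → φ (ENNReal.ofReal (1 - lam) • Q + ENNReal.ofReal lam • R) ≤
      (1 - lam) * φ Q + lam * φ R

lemma isProbabilityMeasure_mixture {X : Type*} [MeasurableSpace X] (Q R : Measure X)
    [IsProbabilityMeasure Q] [IsProbabilityMeasure R] {lam : ℝ} (h0 : 0 ≤ lam) (h1 : lam ≤ 1) :
    IsProbabilityMeasure (ENNReal.ofReal (1 - lam) • Q + ENNReal.ofReal lam • R) := by
  constructor
  simp only [Measure.add_apply, Measure.smul_apply, measure_univ, smul_eq_mul, mul_one]
  rw [← ENNReal.ofReal_add (by linarith) h0]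
  simp

lemma KLdiv_eq_klDiv {X : Type*} [MeasurableSpace X] (Q P : Measure X) [IsProbabilityMeasure Q]
    [IsProbabilityMeasure P] : KLdiv Q P = InformationTheory.klDiv Q P := by
  rw [InformationTheory.klDiv_def, KLdiv]
  simp [llr_def]

lemma KLdiv_mixture_le {X : Type*} [MeasurableSpace X] (P Q R : Measure X)
    [IsProbabilityMeasure P] [IsProbabilityMeasure Q] [IsProbabilityMeasure R] {lam : ℝ}
    (h0 : 0 < lam) (h1 : lam < 1) :
    KLdiv (ENNReal.ofReal (1 - lam) • Q + ENNReal.ofReal lam • R) P ≤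
      ENNReal.ofReal (1 - lam) * KLdiv Q P + ENNReal.ofReal lam * KLdiv R P := by
  have := isProbabilityMeasure_mixture Q R h0.le h1.le
  have h1' : 0 < 1 - lam := by linarith
  simp_rw [KLdiv_eq_klDiv]
  by_cases hQ : Q ≪ P
  swap
  · rw [InformationTheory.klDiv_of_not_ac hQ, ENNReal.mul_top (by simpa using h1)]
    simp
  by_cases hR : R ≪ P
  swap
  · rw [InformationTheory.klDiv_of_not_ac hR, ENNReal.mul_top (by simpa using h0)]
    simp
  have hmix : ENNReal.ofReal (1 - lam) • Q + ENNReal.ofReal lam • R ≪ P :=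
    Measure.AbsolutelyContinuous.add_left (hQ.smul_left _) (hR.smul_left _)
  rw [InformationTheory.klDiv_eq_lintegral_klFun_of_ac hQ,
    InformationTheory.klDiv_eq_lintegral_klFun_of_ac hR,
    InformationTheory.klDiv_eq_lintegral_klFun_of_ac hmix,
    ← lintegral_const_mul _ (by fun_prop), ← lintegral_const_mul _ (by fun_prop),
    ← lintegral_add_left (by fun_prop)]
  refine lintegral_mono_ae ?_
  have hfinQ : IsFiniteMeasure (ENNReal.ofReal (1 - lam) • Q) := by
    constructor
    simp
  have hfinR : IsFiniteMeasure (ENNReal.ofReal lam • R) := by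
    constructor
    simp
  filter_upwards [Measure.rnDeriv_add (ENNReal.ofReal (1 - lam) • Q) (ENNReal.ofReal lam • R) P,
    Measure.rnDeriv_smul_left_of_ne_top Q P (r := ENNReal.ofReal (1 - lam)) ENNReal.ofReal_ne_top,
    Measure.rnDeriv_smul_left_of_ne_top R P (r := ENNReal.ofReal lam) ENNReal.ofReal_ne_top,
    Q.rnDeriv_lt_top P, R.rnDeriv_lt_top P] with x hx hxQ hxR hQt hRt
  rw [hx, Pi.add_apply, hxQ, hxR, Pi.smul_apply, Pi.smul_apply, smul_eq_mul, smul_eq_mul,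
    ENNReal.toReal_add (ENNReal.mul_ne_top ENNReal.ofReal_ne_top hQt.ne)
      (ENNReal.mul_ne_top ENNReal.ofReal_ne_top hRt.ne), ENNReal.toReal_mul, ENNReal.toReal_mul,
    ENNReal.toReal_ofReal h1'.le, ENNReal.toReal_ofReal h0.le,
    ← ENNReal.ofReal_mul h1'.le, ← ENNReal.ofReal_mul h0.le,
    ← ENNReal.ofReal_add (mul_nonneg h1'.le (InformationTheory.klFun_nonneg ENNReal.toReal_nonneg))
      (mul_nonneg h0.le (InformationTheory.klFun_nonneg ENNReal.toReal_nonneg))]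
  refine ENNReal.ofReal_le_ofReal ?_
  have := InformationTheory.convexOn_klFun.2 (x := (Q.rnDeriv P x).toReal)
    (y := (R.rnDeriv P x).toReal) ENNReal.toReal_nonneg ENNReal.toReal_nonneg h1'.le h0.le
    (by ring)
  simpa [smul_eq_mul] using this

lemma MixtureConvex.average_le {X : Type*} [MeasurableSpace X] {φ : Measure X → ℝ}
    (hφ : MixtureConvex φ) {μ : ℕ → Measure X} (hμ : ∀ j, IsProbabilityMeasure (μ j)) {r : ℝ}
    (hr : ∀ j, φ (μ j) ≤ r) (m : ℕ) :
    IsProbabilityMeasure (((m + 1 : ℕ) : ℝ≥0∞)⁻¹ • ∑ j ∈ Finset.range (m + 1), μ j) ∧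
      φ (((m + 1 : ℕ) : ℝ≥0∞)⁻¹ • ∑ j ∈ Finset.range (m + 1), μ j) ≤ r := by
  induction m with
  | zero => simpa using ⟨hμ 0, hr 0⟩
  | succ m ih =>
    obtain ⟨ihp, ihr⟩ := ih
    have hm : (0 : ℝ) < m + 1 := by positivity
    have h0 : 0 < ((m : ℝ) + 2)⁻¹ := by positivity
    have h1 : ((m : ℝ) + 2)⁻¹ < 1 := inv_lt_one_of_one_lt₀ (by linarith)
    have heq : (((m + 1 + 1 : ℕ) : ℝ≥0∞)⁻¹ • ∑ j ∈ Finset.range (m + 1 + 1), μ j) =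
        ENNReal.ofReal (1 - ((m : ℝ) + 2)⁻¹) •
          (((m + 1 : ℕ) : ℝ≥0∞)⁻¹ • ∑ j ∈ Finset.range (m + 1), μ j) +
        ENNReal.ofReal ((m : ℝ) + 2)⁻¹ • μ (m + 1) := by
      have hinv : ∀ k : ℕ, 0 < k → ((k : ℕ) : ℝ≥0∞)⁻¹ = ENNReal.ofReal (k : ℝ)⁻¹ := fun k hk => by
        rw [ENNReal.ofReal_inv_of_pos (by exact_mod_cast hk), ENNReal.ofReal_natCast]
      rw [Finset.sum_range_succ, smul_add, smul_smul, hinv _ (by omega), hinv _ (by omega),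
        ← ENNReal.ofReal_mul (by linarith)]
      congr 3
      · push_cast
        field_simp
        ring
      · push_cast
        ring
    rw [heq]
    refine ⟨isProbabilityMeasure_mixture _ _ h0.le h1.le,
      (hφ _ _ ihp (hμ _) _ h0 h1).trans ?_⟩
    nlinarith [hr (m + 1)]

variable {X : Type*} [MeasurableSpace X] [TopologicalSpace X] [PolishSpace X] [BorelSpace X]

lemma MixtureConvex.averageMarginal_le {φ : Measure X → ℝ} (hφ : MixtureConvex φ)
    (hc : WeaklySeqContinuous φ) {n : ℕ} (hn : n ≠ 0) (R : Measure (Fin n → X))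
    [IsProbabilityMeasure R] {r : ℝ} (hr : ∀ᵐ z ∂(R), φ (empMeasure z) ≤ r) :
    φ (averageMarginal R) ≤ r := by
  have hprob := isProbabilityMeasure_averageMarginal hn R
  have hall : ∀ᵐ ω ∂(Measure.infinitePi fun _ : ℕ => R), ∀ j, φ (empMeasure (ω j)) ≤ r :=
    ae_all_iff.2 fun j =>
      (measurePreserving_eval_infinitePi (fun _ : ℕ => R) j).quasiMeasurePreserving.ae hr
  obtain ⟨ω, hω, hωr⟩ := ((ae_tendsto_integral_empMeasure R).and hall).exists
  have hemp : ∀ j, IsProbabilityMeasure (empMeasure (ω j)) := fun j =>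
    isProbabilityMeasure_empMeasure hn _
  have havg := hφ.average_le hemp hωr
  refine le_of_tendsto (hc _ _ (fun m => (havg m).1) hprob fun f => ?_)
    (Eventually.of_forall fun m => (havg m).2)
  let F : (Fin n → X) →ᵇ ℝ :=
    (n : ℝ)⁻¹ • ∑ i : Fin n, f.compContinuous ⟨fun z => z i, continuous_apply i⟩
  have hF : ∀ z, F z = (∑ i, f (z i)) / (n : ℝ) := fun z => by
    simp [F, div_eq_inv_mul]
  have hlim := hω F
  have hR : ∫ z, F z ∂(R) = ∫ x, f x ∂(averageMarginal R) := by
    simp_rw [hF]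
    rw [integral_averageMarginal R f.continuous.measurable (fun x => f.norm_coe_le_norm x),
      integral_div]
  rw [hR] at hlim
  refine hlim.congr fun m => ?_
  rw [integral_empMeasure _ F.continuous.measurable, integral_smul_measure,
    integral_finsetSum_measure fun j _ => f.integrable _]
  simp_rw [integral_empMeasure _ f.continuous.measurable, hF]
  rw [Finset.sum_range fun j => (∑ i, f (ω j i)) / (n : ℝ)]
  have ht : ((m : ℝ≥0∞) + 1).toReal = (m : ℝ) + 1 := by
    exact_mod_cast ENNReal.toReal_natCast (m + 1)
  simp [div_eq_inv_mul, ht]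

end Convexity

section LargeDeviations

variable {X : Type*} [MeasurableSpace X] [TopologicalSpace X] [PolishSpace X] [BorelSpace X]

lemma exists_KLdiv_le_neg_log_pi (P : Measure X) [IsProbabilityMeasure P] {φ : Measure X → ℝ}
    (hφ : MixtureConvex φ) (hc : WeaklySeqContinuous φ) {n : ℕ} (hn : n ≠ 0) {r : ℝ}
    (hp : (Measure.pi fun _ : Fin n => P) {z | φ (empMeasure z) ≤ r} ≠ 0) :
    ∃ Q : Measure X, IsProbabilityMeasure Q ∧ φ Q ≤ r ∧ KLdiv Q P ≤ ENNReal.ofReal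
      (-Real.log ((Measure.pi fun _ : Fin n => P) {z | φ (empMeasure z) ≤ r}).toReal / n) := by
  set A : Set (Fin n → X) := {z | φ (empMeasure z) ≤ r} with hA
  set μ : Measure (Fin n → X) := Measure.pi fun _ : Fin n => P with hμ
  have hAm : MeasurableSet A := measurableSet_le hc.measurable_empMeasure measurable_const
  have hR : IsProbabilityMeasure (ProbabilityTheory.cond μ A) :=
    ProbabilityTheory.cond_isProbabilityMeasure hp
  have hle : ProbabilityTheory.cond μ A ≤ ((μ A)⁻¹).toNNReal • μ := by
    refine Measure.le_iff.2 fun s _ => ?_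
    rw [ProbabilityTheory.cond_apply hAm, Measure.smul_apply, ENNReal.smul_def, smul_eq_mul,
      ENNReal.coe_toNNReal (ENNReal.inv_ne_top.2 hp)]
    gcongr
    exact Set.inter_subset_right
  refine ⟨averageMarginal (ProbabilityTheory.cond μ A),
    isProbabilityMeasure_averageMarginal hn _,
    hφ.averageMarginal_le hc hn _ (ProbabilityTheory.ae_cond_mem hAm),
    (KLdiv_averageMarginal_le P hn hle).trans (le_of_eq ?_)⟩
  congr 2
  rw [← Real.log_inv, ← ENNReal.toReal_inv]
  rfl

lemma WeaklySeqContinuous.eventually_exp_le_pi (P Q : Measure X) [IsProbabilityMeasure P]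
    [IsProbabilityMeasure Q] {φ : Measure X → ℝ} (hc : WeaklySeqContinuous φ) {a c : ℝ}
    (ha : φ Q < a) (hQ : KLdiv Q P ≠ ⊤) (hQc : (KLdiv Q P).toReal < c) :
    ∀ᶠ n : ℕ in atTop, ENNReal.ofReal (Real.exp (-(n * c))) ≤
      (Measure.pi fun _ : Fin n => P) {z | φ (empMeasure z) < a} := by
  obtain ⟨b, hb, hbc⟩ := exists_between hQc
  have hcond : Q ≪ P ∧ Integrable (fun x => Real.log (Q.rnDeriv P x).toReal) Q := by
    by_contra h
    exact hQ (if_neg h)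
  have hlogint : ∫ x, Real.log (Q.rnDeriv P x).toReal ∂Q < b := by
    refine lt_of_le_of_lt ?_ hb
    rw [KLdiv, if_pos hcond]
    rw [ENNReal.toReal_ofReal']
    exact le_max_left _ _
  have hlim := hc.tendsto_pi Q ha (f := fun x => Real.log (Q.rnDeriv P x).toReal) (by fun_prop)
    hcond.2 hlogint
  have hhalf : ENNReal.ofReal (1 / 2) < 1 := by
    rw [ENNReal.ofReal_lt_one]
    norm_num
  filter_upwards [hlim.eventually (lt_mem_nhds hhalf),
    eventually_ge_atTop ⌈Real.log 2 / (c - b)⌉₊] with n hn hnl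
  have hsum : Measurable fun z : Fin n → X => ∑ i, Real.log (Q.rnDeriv P (z i)).toReal :=
    Finset.measurable_fun_sum _ fun i _ => by fun_prop
  have hE : MeasurableSet {z : Fin n → X | φ (empMeasure z) < a ∧
      ∑ i, Real.log (Q.rnDeriv P (z i)).toReal ≤ n * b} :=
    (measurableSet_lt hc.measurable_empMeasure measurable_const).inter
      (measurableSet_le hsum measurable_const)
  have h1 := pi_le_exp_mul_pi P Q hcond.1 hE (b := n * b) fun z hz => hz.2
  have h2 := hn.le.trans h1
  have hlog : Real.log 2 ≤ n * (c - b) := by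
    have := Nat.ceil_le.1 hnl
    rwa [div_le_iff₀ (by linarith)] at this
  have hexp : Real.exp (-(n * c)) ≤ Real.exp (-(n * b)) * (1 / 2) := by
    have h2e : (1 / 2 : ℝ) = Real.exp (-Real.log 2) := by
      rw [Real.exp_neg, Real.exp_log two_pos, one_div]
    rw [h2e, ← Real.exp_add]
    exact Real.exp_le_exp.2 (by linarith)
  calc ENNReal.ofReal (Real.exp (-(n * c)))
      ≤ ENNReal.ofReal (Real.exp (-(n * b)) * (1 / 2)) := ENNReal.ofReal_le_ofReal hexp
    _ = ENNReal.ofReal (Real.exp (-(n * b))) * ENNReal.ofReal (1 / 2) :=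
        ENNReal.ofReal_mul (Real.exp_pos _).le
    _ ≤ ENNReal.ofReal (Real.exp (-(n * b))) * (ENNReal.ofReal (Real.exp (n * b)) *
          (Measure.pi fun _ : Fin n => P) {z | φ (empMeasure z) < a ∧
            ∑ i, Real.log (Q.rnDeriv P (z i)).toReal ≤ n * b}) := by gcongr
    _ = (Measure.pi fun _ : Fin n => P) {z | φ (empMeasure z) < a ∧
            ∑ i, Real.log (Q.rnDeriv P (z i)).toReal ≤ n * b} := by
        rw [← mul_assoc, ← ENNReal.ofReal_mul (Real.exp_pos _).le, ← Real.exp_add]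
        simp
    _ ≤ _ := measure_mono fun z hz => hz.1

end LargeDeviations

section Perturbation

variable {X : Type*} [MeasurableSpace X]

lemma KLdiv_mixture_le_add (P Q R : Measure X) [IsProbabilityMeasure P] [IsProbabilityMeasure Q]
    [IsProbabilityMeasure R] {lam : ℝ} (h0 : 0 < lam) (h1 : lam < 1) :
    KLdiv (ENNReal.ofReal (1 - lam) • Q + ENNReal.ofReal lam • R) P ≤
      KLdiv Q P + ENNReal.ofReal lam * KLdiv R P := by
  refine (KLdiv_mixture_le P Q R h0 h1).trans ?_
  gcongr
  exact mul_le_of_le_one_left' (by simpa using h0.le)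

lemma exists_mixing_weight {K δ : ℝ} (hK : 0 ≤ K) (hδ : 0 < δ) :
    ∃ lam : ℝ, 0 < lam ∧ lam < 1 ∧ lam * K ≤ δ := by
  refine ⟨min (1 / 2) (δ / (K + 1)), by positivity,
    (min_le_left _ _).trans_lt (by norm_num), ?_⟩
  calc min (1 / 2) (δ / (K + 1)) * K ≤ δ / (K + 1) * (K + 1) := by
        gcongr
        · exact min_le_right _ _
        · linarith
    _ = δ := by field_simp

end Perturbation

/-- Asymptotics of the coarsened likelihood on a Polish space: under an i.i.d. sample from
`P0`, `(1/n) log L_ε(θ|x_{1:n}) → − I_ε(θ)` in probability. -/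
theorem stmt10 {X : Type*} [MeasurableSpace X] [TopologicalSpace X] [PolishSpace X]
    [BorelSpace X]
    (P0 Pθ : Measure X) [IsProbabilityMeasure P0] [IsProbabilityMeasure Pθ]
    (D : Measure X → Measure X → ℝ)
    (hDnonneg : ∀ P Q : Measure X, IsProbabilityMeasure P → IsProbabilityMeasure Q →
      0 ≤ D P Q)
    (hDrefl : ∀ P : Measure X, IsProbabilityMeasure P → D P P = 0)
    (hDsymm : ∀ P Q : Measure X, IsProbabilityMeasure P → IsProbabilityMeasure Q →
      D P Q = D Q P)
    (hDtri : ∀ P Q R : Measure X, IsProbabilityMeasure P → IsProbabilityMeasure Q →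
      IsProbabilityMeasure R → D P Q ≤ D P R + D R Q)
    (hDconv : ∀ P Q R : Measure X, IsProbabilityMeasure P → IsProbabilityMeasure Q →
      IsProbabilityMeasure R → ∀ lam : ℝ, 0 < lam → lam < 1 →
      D P (ENNReal.ofReal (1 - lam) • Q + ENNReal.ofReal lam • R) ≤
        (1 - lam) * D P Q + lam * D P R)
    (hDcont : ∀ (Ps : ℕ → Measure X) (P Q : Measure X),
      (∀ n, IsProbabilityMeasure (Ps n)) → IsProbabilityMeasure P →
      IsProbabilityMeasure Q →
      (∀ f : X →ᵇ ℝ, Tendsto (fun n => ∫ x, f x ∂(Ps n)) atTop (𝓝 (∫ x, f x ∂P))) →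
      Tendsto (fun n => D (Ps n) Q) atTop (𝓝 (D P Q)))
    (ε0 : ℝ) (hε0 : 0 ≤ ε0) (hI0 : OKLD D P0 Pθ ε0 ≠ ⊤)
    (ε : ℝ) (hε : ε0 < ε) :
    ∀ δ : ℝ, 0 < δ →
      Tendsto (fun n : ℕ => (Measure.pi fun _ : Fin n => P0)
          {x : Fin n → X |
            δ < |(1 / (n : ℝ)) * Real.log ((coarsenedLik D Pθ x ε).toReal) +
              (OKLD D P0 Pθ ε).toReal|})
        atTop (𝓝 0) := by
  intro δ hδ
  have hφc : MixtureConvex fun Q => D Q P0 := fun Q R hQ hR lam h0 h1 => by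
    have := isProbabilityMeasure_mixture Q R h0.le h1.le
    simpa only [hDsymm _ P0 ‹_› ‹_›, hDsymm Q P0 hQ ‹_›, hDsymm R P0 hR ‹_›] using
      hDconv P0 Q R ‹_› hQ hR lam h0 h1
  have hφ : WeaklySeqContinuous fun Q => D Q P0 := fun Ps P hPs hP h =>
    hDcont Ps P P0 hPs hP ‹_› h
  obtain ⟨Q0, ⟨hQ0, hQ0ε⟩, hQ0K⟩ : ∃ Q ∈ {Q : Measure X | IsProbabilityMeasure Q ∧ D Q P0 ≤ ε0},
      KLdiv Q Pθ < ⊤ := by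
    simpa only [OKLD, iInf_lt_iff, exists_prop] using hI0.lt_top
  have hI : OKLD D P0 Pθ ε ≠ ⊤ :=
    ((iInf₂_le Q0 ⟨hQ0, hQ0ε.trans hε.le⟩).trans_lt hQ0K).ne
  obtain ⟨lam, h0, h1, hlam⟩ := exists_mixing_weight
    (ENNReal.toReal_nonneg (a := KLdiv Q0 Pθ)) (half_pos hδ)
  have hlam' : ENNReal.ofReal lam * KLdiv Q0 Pθ ≤ ENNReal.ofReal (δ / 2) := by
    rw [← ENNReal.ofReal_toReal hQ0K.ne, ← ENNReal.ofReal_mul h0.le]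
    exact ENNReal.ofReal_le_ofReal hlam
  obtain ⟨Q, ⟨hQ, hQε⟩, hQK⟩ : ∃ Q ∈ {Q : Measure X | IsProbabilityMeasure Q ∧ D Q P0 ≤ ε},
      KLdiv Q Pθ < OKLD D P0 Pθ ε + ENNReal.ofReal (δ / 2) := by
    have : OKLD D P0 Pθ ε < OKLD D P0 Pθ ε + ENNReal.ofReal (δ / 2) :=
      ENNReal.lt_add_right hI (by simpa using hδ)
    conv_lhs at this => rw [OKLD]
    simpa only [iInf_lt_iff, exists_prop] using this
  obtain ⟨Q1, hQ1, hQ1ε, hQ1K⟩ : ∃ Q1 : Measure X, IsProbabilityMeasure Q1 ∧ D Q1 P0 < ε ∧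
      KLdiv Q1 Pθ < OKLD D P0 Pθ ε + ENNReal.ofReal δ := by
    refine ⟨_, isProbabilityMeasure_mixture Q Q0 h0.le h1.le,
      (hφc Q Q0 hQ hQ0 lam h0 h1).trans_lt (by nlinarith),
      (KLdiv_mixture_le_add Pθ Q Q0 h0 h1).trans_lt ?_⟩
    rw [← add_halves δ, ENNReal.ofReal_add (half_pos hδ).le (half_pos hδ).le, ← add_assoc]
    exact ENNReal.add_lt_add_of_lt_of_le (ne_top_of_le_ne_top ENNReal.ofReal_ne_top hlam') hQK
      hlam'
  have hQ1c : (KLdiv Q1 Pθ).toReal < (OKLD D P0 Pθ ε).toReal + δ := by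
    have := ENNReal.toReal_strict_mono (ENNReal.add_ne_top.2 ⟨hI, ENNReal.ofReal_ne_top⟩) hQ1K
    rwa [ENNReal.toReal_add hI ENNReal.ofReal_ne_top, ENNReal.toReal_ofReal hδ.le] at this
  obtain ⟨a, hQ1a, haε⟩ := exists_between hQ1ε
  have hlower := hφ.eventually_exp_le_pi Pθ Q1 hQ1a hQ1K.ne_top hQ1c
  have hη1 : 0 < lam * (ε - ε0) := mul_pos h0 (sub_pos.2 hε)
  have hη : 0 < min (lam * (ε - ε0)) (ε - a) := lt_min hη1 (sub_pos.2 haε)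
  set η := min (lam * (ε - ε0)) (ε - a) with hη_def
  have hupper : ∀ n : ℕ, n ≠ 0 →
      (Measure.pi fun _ : Fin n => Pθ) {z | D (empMeasure z) P0 ≤ ε + η} ≠ 0 →
      (OKLD D P0 Pθ ε).toReal ≤ -Real.log ((Measure.pi fun _ : Fin n => Pθ)
        {z | D (empMeasure z) P0 ≤ ε + η}).toReal / n + δ := by
    intro n hn hp
    obtain ⟨R, hR, hRε, hRK⟩ := exists_KLdiv_le_neg_log_pi Pθ hφc hφ hn hp
    have hlog : 0 ≤ -Real.log ((Measure.pi fun _ : Fin n => Pθ)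
        {z | D (empMeasure z) P0 ≤ ε + η}).toReal / n :=
      div_nonneg (neg_nonneg.2 (Real.log_nonpos ENNReal.toReal_nonneg
        (ENNReal.toReal_le_of_le_ofReal zero_le_one (by simpa using prob_le_one))))
        n.cast_nonneg
    have hmix : OKLD D P0 Pθ ε ≤ KLdiv R Pθ + ENNReal.ofReal lam * KLdiv Q0 Pθ := by
      refine (iInf₂_le _ ⟨isProbabilityMeasure_mixture R Q0 h0.le h1.le,
        (hφc R Q0 hR hQ0 lam h0 h1).trans ?_⟩).trans (KLdiv_mixture_le_add Pθ R Q0 h0 h1)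
      have hηle : η ≤ lam * (ε - ε0) := min_le_left _ _
      nlinarith
    refine ENNReal.toReal_le_of_le_ofReal (by linarith) (hmix.trans ?_)
    rw [ENNReal.ofReal_add hlog hδ.le]
    exact add_le_add hRK (hlam'.trans (ENNReal.ofReal_le_ofReal (by linarith)))
  have hP0 : Tendsto (fun n : ℕ => (Measure.pi fun _ : Fin n => P0)
      {x | D (empMeasure x) P0 < η}) atTop (𝓝 1) := by
    have := hφ.tendsto_pi P0 (a := η) (c := 1) (f := fun _ => 0) (by rwa [hDrefl P0 ‹_›])
      measurable_const (integrable_const 0) (by simp)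
    simpa using this
  have hcompl : Tendsto (fun n : ℕ => (Measure.pi fun _ : Fin n => P0)
      {x | D (empMeasure x) P0 < η}ᶜ) atTop (𝓝 0) := by
    have hsub := ENNReal.Tendsto.sub (tendsto_const_nhds (x := (1 : ℝ≥0∞))) hP0
      (Or.inl ENNReal.one_ne_top)
    rw [tsub_self] at hsub
    refine hsub.congr fun n => ?_
    rw [prob_compl_eq_one_sub (measurableSet_lt hφ.measurable_empMeasure measurable_const)]
  refine tendsto_of_tendsto_of_tendsto_of_le_of_le' tendsto_const_nhds hcompl
    (Eventually.of_forall fun _ => zero_le) ?_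
  filter_upwards [hlower, eventually_ne_atTop 0] with n hn hn0
  refine measure_mono fun x hx hxη => ?_
  rw [Set.mem_ofPred_eq] at hx
  refine absurd hx (not_lt.2 ?_)
  have hxη : D (empMeasure x) P0 < η := hxη
  have hn' : (0 : ℝ) < n := by positivity
  have hemp : ∀ z : Fin n → X, IsProbabilityMeasure (empMeasure z) :=
    isProbabilityMeasure_empMeasure hn0
  have hge : (Measure.pi fun _ : Fin n => Pθ) {z | D (empMeasure z) P0 < a} ≤
      coarsenedLik D Pθ x ε := measure_mono fun z (hz : D (empMeasure z) P0 < a) => by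
    have h2 : η ≤ ε - a := min_le_right _ _
    have h3 := hDtri (empMeasure z) (empMeasure x) P0 (hemp z) (hemp x) ‹_›
    rw [hDsymm P0 (empMeasure x) ‹_› (hemp x)] at h3
    show D (empMeasure z) (empMeasure x) ≤ ε
    linarith
  have hle : coarsenedLik D Pθ x ε ≤
      (Measure.pi fun _ : Fin n => Pθ) {z | D (empMeasure z) P0 ≤ ε + η} :=
    measure_mono fun z (hz : D (empMeasure z) (empMeasure x) ≤ ε) => by
      have h3 := hDtri (empMeasure z) P0 (empMeasure x) (hemp z) ‹_› (hemp x)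
      show D (empMeasure z) P0 ≤ ε + η
      linarith
  have hLtop : coarsenedLik D Pθ x ε ≠ ⊤ := measure_ne_top _ _
  have hexp : Real.exp (-(n * ((OKLD D P0 Pθ ε).toReal + δ))) ≤ (coarsenedLik D Pθ x ε).toReal :=
    (ENNReal.ofReal_le_iff_le_toReal hLtop).1 (hn.trans hge)
  have hLpos : 0 < (coarsenedLik D Pθ x ε).toReal := (Real.exp_pos _).trans_le hexp
  have hlow := (Real.le_log_iff_exp_le hLpos).2 hexp
  have hup := hupper n hn0
    ((ENNReal.toReal_pos_iff.1 hLpos).1.trans_le hle).ne'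
  have hlogle := Real.log_le_log hLpos (ENNReal.toReal_mono (measure_ne_top _ _) hle)
  rw [abs_le]
  constructor
  · have : -((OKLD D P0 Pθ ε).toReal + δ) ≤
        1 / (n : ℝ) * Real.log (coarsenedLik D Pθ x ε).toReal := by
      rw [one_div, inv_mul_eq_div, le_div_iff₀ hn']
      linarith
    linarith
  · have := div_le_div_of_nonneg_right hlogle hn'.le
    rw [one_div, inv_mul_eq_div]
    rw [neg_div] at hup
    linarith
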